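/- Assume T(𝓛) acts transitively on 𝓛 and contains a transposition. Then T(𝓛) is the full symmetric group on 𝓛. -/

import Mathlib

open scoped symmDiff

namespace TogglePaper

variable {E : Type*} [DecidableEq E]

/-- The toggle `τ_e` on the collection `L` of subsets of the ground set. -/
def toggle (L : Finset (Finset E)) (e : E) : Equiv.Perm {A : Finset E // A ∈ L} :=
  Function.Involutive.toPerm
    (fun X => if h : X.1 ∆ ({e} : Finset E) ∈ L then ⟨X.1 ∆ ({e} : Finset E), h⟩ else X)
    (by
      intro X
      by_cases h : X.1 ∆ ({e} : Finset E) ∈ L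
      · have h2 : (X.1 ∆ ({e} : Finset E)) ∆ ({e} : Finset E) = X.1 :=
          symmDiff_symmDiff_cancel_right _ _
        simp only [dif_pos h, h2]
        simp [h2, X.2]
      · simp [h])

/-- The generalized toggle group `T(L)`. -/
def toggleGroup (L : Finset (Finset E)) : Subgroup (Equiv.Perm {A : Finset E // A ∈ L}) :=
  Subgroup.closure (Set.range (toggle L))

/-- `T(L)` acts transitively on `L`. -/
def IsTransitive (L : Finset (Finset E)) : Prop :=
  ∀ A B : {A : Finset E // A ∈ L}, ∃ g ∈ toggleGroup L, g A = B

/-- `B` is a block for the action of `T(L)` on `L`. -/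
def IsBlock (L : Finset (Finset E)) (B : Finset {A : Finset E // A ∈ L}) : Prop :=
  ∀ g ∈ toggleGroup L, Finset.image g B = B ∨ Disjoint (Finset.image g B) B

/-- `Blocks` is a block system for `T(L)`: a partition of `L` into nonempty blocks
that is permuted by every element of `T(L)`. -/
def IsBlockSystem (L : Finset (Finset E))
    (Blocks : Finset (Finset {A : Finset E // A ∈ L})) : Prop :=
  (∀ B ∈ Blocks, B.Nonempty) ∧
  (∀ A : {A : Finset E // A ∈ L}, ∃! B : Finset {A : Finset E // A ∈ L},
      B ∈ Blocks ∧ A ∈ B) ∧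
  (∀ g ∈ toggleGroup L, ∀ B ∈ Blocks, Finset.image g B ∈ Blocks)

/-- An element `g` of `T(L)` is type 2 (with respect to a fixed block system `Blocks`)
if it maps each block to itself; it is type 1 otherwise. -/
def IsType2 (L : Finset (Finset E)) (Blocks : Finset (Finset {A : Finset E // A ∈ L}))
    (g : Equiv.Perm {A : Finset E // A ∈ L}) : Prop :=
  ∀ B ∈ Blocks, Finset.image g B = B

/-- The action of `T(L)` on `L` is primitive: it is transitive and the only blocks
are the singletons, the empty set and the whole set. -/
def IsPrimitive (L : Finset (Finset E)) : Prop :=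
  IsTransitive L ∧
    ∀ B : Finset {A : Finset E // A ∈ L}, IsBlock L B → B.card ≤ 1 ∨ B = Finset.univ

/-- `T(L)` contains a long cycle, i.e. a cycle whose support is all of `L`. -/
def HasLongCycle (L : Finset (Finset E)) : Prop :=
  ∃ g ∈ toggleGroup L, g.IsCycle ∧ g.support = Finset.univ

theorem toggle_involutive (L : Finset (Finset E)) (e : E) : Function.Involutive (toggle L e) :=
  Function.Involutive.toPerm_involutive _

theorem toggle_mul_self (L : Finset (Finset E)) (e : E) : toggle L e * toggle L e = 1 :=
  Equiv.ext (toggle_involutive L e)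

theorem toggle_mem (L : Finset (Finset E)) (e : E) : toggle L e ∈ toggleGroup L :=
  Subgroup.subset_closure ⟨e, rfl⟩

theorem toggle_val_of_mem {L : Finset (Finset E)} {e : E} {Z : {A : Finset E // A ∈ L}}
    (h : Z.1 ∆ {e} ∈ L) : (toggle L e Z).1 = Z.1 ∆ {e} :=
  congrArg Subtype.val (dif_pos h)

theorem toggle_ne_self_iff {L : Finset (Finset E)} {e : E} {Z : {A : Finset E // A ∈ L}} :
    toggle L e Z ≠ Z ↔ Z.1 ∆ {e} ∈ L := by
  constructor
  · intro h
    by_contra h'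
    exact h (dif_neg h')
  · intro h h'
    have h2 := toggle_val_of_mem h
    rw [h'] at h2
    simpa using h2.symm

theorem toggle_val_of_ne {L : Finset (Finset E)} {e : E} {Z : {A : Finset E // A ∈ L}}
    (h : toggle L e Z ≠ Z) : (toggle L e Z).1 = Z.1 ∆ {e} :=
  toggle_val_of_mem (toggle_ne_self_iff.1 h)

theorem mem_toggle_iff_of_ne {L : Finset (Finset E)} {e f : E} (hef : e ≠ f)
    (Z : {A : Finset E // A ∈ L}) : e ∈ (toggle L f Z).1 ↔ e ∈ Z.1 := by
  by_cases h : toggle L f Z = Z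
  · rw [h]
  · rw [toggle_val_of_ne h]
    simp [Finset.mem_symmDiff, hef]

/-- A property preserved by all toggles is preserved by the whole toggle group. -/
theorem apply_iff_of_toggle {L : Finset (Finset E)} {P : {A : Finset E // A ∈ L} → Prop}
    (hP : ∀ e Z, P Z → P (toggle L e Z)) {g : Equiv.Perm {A : Finset E // A ∈ L}}
    (hg : g ∈ toggleGroup L) (Z : {A : Finset E // A ∈ L}) : P (g Z) ↔ P Z := by
  induction hg using Subgroup.closure_induction generalizing Z with
  | mem x hx =>
    obtain ⟨e, rfl⟩ := hx
    refine ⟨fun h => ?_, hP e Z⟩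
    simpa [toggle_involutive L e Z] using hP e _ h
  | one => rfl
  | mul x y _ _ hx hy => rw [Equiv.Perm.mul_apply, hx, hy]
  | inv x _ hx => rw [← hx (x⁻¹ Z), ← Equiv.Perm.mul_apply, mul_inv_cancel, Equiv.Perm.one_apply]

theorem IsTransitive.forall_of_toggle {L : Finset (Finset E)} (htrans : IsTransitive L)
    {P : {A : Finset E // A ∈ L} → Prop} (hP : ∀ e Z, P Z → P (toggle L e Z))
    {A : {A : Finset E // A ∈ L}} (hA : P A) (Z : {A : Finset E // A ∈ L}) : P Z := by
  obtain ⟨g, hg, rfl⟩ := htrans A Z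
  exact (apply_iff_of_toggle hP hg A).2 hA

/-- Two members of `L` are swappable if the toggle group contains the permutation swapping them. -/
def Swappable (L : Finset (Finset E)) (Z W : {A : Finset E // A ∈ L}) : Prop :=
  Equiv.swap Z W ∈ toggleGroup L

namespace Swappable

variable {L : Finset (Finset E)} {Z W U : {A : Finset E // A ∈ L}}

theorem refl (Z : {A : Finset E // A ∈ L}) : Swappable L Z Z := by
  rw [Swappable, Equiv.swap_self]
  exact one_mem _

theorem symm (h : Swappable L Z W) : Swappable L W Z := by
  rwa [Swappable, Equiv.swap_comm]

theorem trans (h : Swappable L Z W) (h' : Swappable L W U) : Swappable L Z U :=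
  SubmonoidClass.swap_mem_trans _ h h'

theorem toggle (h : Swappable L Z W) (e : E) :
    Swappable L (toggle L e Z) (TogglePaper.toggle L e W) := by
  rw [Swappable, Equiv.swap_apply_apply]
  exact mul_mem (mul_mem (toggle_mem L e) h) (inv_mem (toggle_mem L e))

theorem toggle_self (h : Swappable L Z W) {e : E}
    (hZ : Swappable L Z (TogglePaper.toggle L e Z)) :
    Swappable L W (TogglePaper.toggle L e W) :=
  h.symm.trans (hZ.trans (h.toggle e))

end Swappable

/-- `e` is inner if `toggle L e` maps every member of `L` to a swappable one. -/
def IsInner (L : Finset (Finset E)) (e : E) : Prop :=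
  ∀ Z, Swappable L Z (toggle L e Z)

/-- `e` is outer if `toggle L e` moves no member of `L` to a swappable one. -/
def IsOuter (L : Finset (Finset E)) (e : E) : Prop :=
  ∀ Z, Swappable L Z (toggle L e Z) → toggle L e Z = Z

theorem IsOuter.toggle_ne {L : Finset (Finset E)} {e : E} (he : IsOuter L e)
    {Z W : {A : Finset E // A ∈ L}} (h : Swappable L Z W) (hZ : toggle L e Z ≠ Z) :
    toggle L e W ≠ W := by
  intro hW
  refine hZ (he Z (h.symm.toggle_self ?_))
  rw [hW]
  exact Swappable.refl W

/-- If some `e`-toggle is between swappable members, then each swappability class contains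
such a toggle. -/
theorem exists_swappable_toggle_ne {L : Finset (Finset E)} (htrans : IsTransitive L) {e : E}
    (he : ¬ IsOuter L e) (Z : {A : Finset E // A ∈ L}) :
    ∃ W, Swappable L Z W ∧ Swappable L W (toggle L e W) ∧ toggle L e W ≠ W := by
  obtain ⟨A, hA, hA'⟩ : ∃ A, Swappable L A (toggle L e A) ∧ toggle L e A ≠ A := by
    simpa [IsOuter] using he
  refine htrans.forall_of_toggle (P := fun Z => ∃ W, Swappable L Z W ∧
    Swappable L W (toggle L e W) ∧ toggle L e W ≠ W) ?_ ⟨A, Swappable.refl A, hA, hA'⟩ Z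
  rintro f Z ⟨W, hZW, hW, hne⟩
  by_cases hf : Swappable L W (toggle L f W)
  · exact ⟨W, (hZW.toggle f).trans hf.symm, hW, hne⟩
  have hWf : toggle L f W ≠ W := fun h => hf (by rw [h]; exact Swappable.refl W)
  have heWf : toggle L f (toggle L e W) ≠ toggle L e W := fun h =>
    hf (hW.symm.toggle_self (by rw [h]; exact Swappable.refl _))
  have hval : (toggle L f W).1 ∆ {e} = (toggle L f (toggle L e W)).1 := by
    rw [toggle_val_of_ne heWf, toggle_val_of_ne hne, toggle_val_of_ne hWf, symmDiff_right_comm]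
  have hmem : (toggle L f W).1 ∆ {e} ∈ L := hval ▸ (toggle L f (toggle L e W)).2
  have heq : toggle L e (toggle L f W) = toggle L f (toggle L e W) :=
    Subtype.ext ((toggle_val_of_mem hmem).trans hval)
  exact ⟨toggle L f W, hZW.toggle f, heq ▸ hW.toggle f, toggle_ne_self_iff.2 hmem⟩

theorem isInner_of_not_isOuter {L : Finset (Finset E)} (htrans : IsTransitive L) {e : E}
    (he : ¬ IsOuter L e) : IsInner L e := by
  intro Z
  obtain ⟨W, hZW, hW, -⟩ := exists_swappable_toggle_ne htrans he Z
  exact hZW.symm.toggle_self hW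

theorem IsInner.toggle_comm {L : Finset (Finset E)} {e f : E} (he : IsInner L e)
    (hf : IsOuter L f) (Z : {A : Finset E // A ∈ L}) :
    toggle L e (toggle L f Z) = toggle L f (toggle L e Z) := by
  by_cases hfZ : toggle L f Z = Z
  · have : toggle L f (toggle L e Z) = toggle L e Z := by
      by_contra h
      exact hf.toggle_ne (he Z).symm h hfZ
    rw [hfZ, this]
  have hfeZ : toggle L f (toggle L e Z) ≠ toggle L e Z := hf.toggle_ne (he Z) hfZ
  by_cases heZ : toggle L e Z = Z
  · rw [heZ]
    by_contra h
    have hffZ : toggle L f (toggle L f Z) ≠ toggle L f Z := by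
      rw [toggle_involutive L f Z]; exact Ne.symm hfZ
    have h1 := toggle_val_of_ne (hf.toggle_ne (he (toggle L f Z)) hffZ)
    rw [toggle_val_of_ne h, toggle_val_of_ne hfZ, symmDiff_right_comm,
      symmDiff_symmDiff_cancel_right] at h1
    exact toggle_ne_self_iff.2 (h1 ▸ Subtype.property _) heZ
  · have hval : (toggle L f Z).1 ∆ {e} = (toggle L f (toggle L e Z)).1 := by
      rw [toggle_val_of_ne hfeZ, toggle_val_of_ne heZ, toggle_val_of_ne hfZ, symmDiff_right_comm]
    have hmem : (toggle L f Z).1 ∆ {e} ∈ L := hval ▸ Subtype.property _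
    exact Subtype.ext ((toggle_val_of_mem hmem).trans hval)

/-- Reachability by outer toggles is preserved by the toggle group. -/
theorem reflTransGen_outer_apply {L : Finset (Finset E)} (htrans : IsTransitive L)
    {g : Equiv.Perm {A : Finset E // A ∈ L}} (hg : g ∈ toggleGroup L)
    {Z W : {A : Finset E // A ∈ L}}
    (h : Relation.ReflTransGen (fun Z W => ∃ f, IsOuter L f ∧ W = toggle L f Z) Z W) :
    Relation.ReflTransGen (fun Z W => ∃ f, IsOuter L f ∧ W = toggle L f Z) (g Z) (g W) := by
  have key : ∀ e Z W,
      Relation.ReflTransGen (fun Z W => ∃ f, IsOuter L f ∧ W = toggle L f Z) Z W →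
      Relation.ReflTransGen (fun Z W => ∃ f, IsOuter L f ∧ W = toggle L f Z)
        (toggle L e Z) (toggle L e W) := by
    intro e Z W h
    by_cases he : IsOuter L e
    · exact (Relation.ReflTransGen.head ⟨e, he, (toggle_involutive L e Z).symm⟩ h).tail
        ⟨e, he, rfl⟩
    · refine h.lift (toggle L e) ?_
      rintro A _ ⟨f, hf, rfl⟩
      exact ⟨f, hf, (isInner_of_not_isOuter htrans he).toggle_comm hf A⟩
  induction hg using Subgroup.closure_induction'' generalizing Z W with
  | mem x hx =>
    obtain ⟨e, rfl⟩ := hx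
    exact key e Z W h
  | inv_mem x hx =>
    obtain ⟨e, rfl⟩ := hx
    rw [inv_eq_of_mul_eq_one_left (toggle_mul_self L e)]
    exact key e Z W h
  | one => exact h
  | mul x y _ _ hx hy => exact hx (hy h)

theorem isInner_of_exists_not_isOuter {L : Finset (Finset E)} (htrans : IsTransitive L) {e : E}
    (he : ¬ IsOuter L e) (f : E) : IsInner L f := by
  by_cases hf : IsOuter L f
  · intro Z
    by_contra hZ
    have hfZ : toggle L f Z ≠ Z := fun h => hZ (by rw [h]; exact Swappable.refl Z)
    obtain ⟨W, hZW, hW, hne⟩ := exists_swappable_toggle_ne htrans he Z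
    have hfW : toggle L f W ≠ W := hf.toggle_ne hZW hfZ
    have hef : e ≠ f := fun h => he (h ▸ hf)
    have hreach := reflTransGen_outer_apply htrans hW
      (Relation.ReflTransGen.single ⟨f, hf, rfl⟩ : Relation.ReflTransGen
        (fun Z W => ∃ f, IsOuter L f ∧ W = toggle L f Z) W (toggle L f W))
    have hfe : toggle L f W ≠ toggle L e W := by
      intro h
      have h1 := congrArg Subtype.val h
      rw [toggle_val_of_ne hfW, toggle_val_of_ne hne, symmDiff_right_inj] at h1
      exact hef (Finset.singleton_injective h1).symm
    rw [Equiv.swap_apply_left, Equiv.swap_apply_of_ne_of_ne hfW hfe] at hreach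
    have hmem : ∀ A B, Relation.ReflTransGen
        (fun Z W => ∃ f, IsOuter L f ∧ W = toggle L f Z) A B → (e ∈ A.1 ↔ e ∈ B.1) := by
      intro A B h
      induction h with
      | refl => rfl
      | tail _ h ih =>
        obtain ⟨k, hk, rfl⟩ := h
        rw [ih, mem_toggle_iff_of_ne (ne_of_mem_of_not_mem (s := {x | IsOuter L x}) hk he).symm]
    have h2 := hmem _ _ hreach
    rw [mem_toggle_iff_of_ne hef, toggle_val_of_ne hne] at h2
    simp [Finset.mem_symmDiff] at h2
  · exact isInner_of_not_isOuter htrans hf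

/-- A permutation commuting with one that exchanges an invariant set with its complement
is even. -/
theorem sign_eq_one_of_commute_of_exchange {α : Type*} [Fintype α] [DecidableEq α]
    {τ σ : Equiv.Perm α} (hcomm : ∀ x, σ (τ x) = τ (σ x)) (p : α → Prop) [DecidablePred p]
    (hτ : ∀ x, p (τ x) ↔ p x) (hσ : ∀ x, p x ↔ ¬ p (σ x)) : Equiv.Perm.sign τ = 1 := by
  have hτ' : ∀ x, ¬ p (τ x) ↔ ¬ p x := fun x => not_congr (hτ x)
  have hsplit : τ = (τ.subtypePerm hτ).subtypeCongr (τ.subtypePerm hτ') := by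
    ext x
    by_cases hx : p x
    · simp [hx]
    · simp [hx]
  have hsign : Equiv.Perm.sign (τ.subtypePerm hτ) = Equiv.Perm.sign (τ.subtypePerm hτ') :=
    Equiv.Perm.sign_eq_sign_of_equiv _ _ (σ.subtypeEquiv (q := fun x => ¬ p x) hσ)
      (fun x => Subtype.ext (hcomm x))
  rw [hsplit, Equiv.Perm.sign_subtypeCongr, hsign, Int.units_mul_self]

/-- If no toggle exchanges swappable members, every toggle commutes with translation by the
difference of a swappable pair, and is therefore even. -/
theorem sign_toggle_eq_one_of_forall_isOuter {L : Finset (Finset E)} (htrans : IsTransitive L)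
    (hout : ∀ e, IsOuter L e) {X Y : {A : Finset E // A ∈ L}} (hXY : X ≠ Y)
    (hsw : Swappable L X Y) (e : E) : Equiv.Perm.sign (toggle L e) = 1 := by
  have hpair : ∀ Z : {A : Finset E // A ∈ L},
      ∃ h : Z.1 ∆ (X.1 ∆ Y.1) ∈ L, Swappable L Z ⟨_, h⟩ := by
    refine htrans.forall_of_toggle (A := X) ?_ ?_
    · rintro f Z ⟨hm, hs⟩
      suffices h : (toggle L f Z).1 ∆ (X.1 ∆ Y.1) = (toggle L f ⟨_, hm⟩).1 by
        refine ⟨h ▸ Subtype.property _, ?_⟩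
        have h2 := hs.toggle f
        convert! h2
      by_cases hf : toggle L f Z = Z
      · have hf' : toggle L f ⟨_, hm⟩ = ⟨_, hm⟩ := by
          by_contra h
          exact (hout f).toggle_ne hs.symm h hf
        rw [hf, hf']
      · rw [toggle_val_of_ne hf, toggle_val_of_ne ((hout f).toggle_ne hs hf),
          symmDiff_right_comm]
    · have h : X.1 ∆ (X.1 ∆ Y.1) = Y.1 := symmDiff_symmDiff_cancel_left _ _
      refine ⟨h.symm.subst (motive := (· ∈ L)) Y.2, ?_⟩
      convert! hsw
  choose hm hs using hpair
  have hinv : Function.Involutive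
      (fun Z : {A : Finset E // A ∈ L} => (⟨Z.1 ∆ (X.1 ∆ Y.1), hm Z⟩ : {A : Finset E // A ∈ L})) :=
    fun Z => Subtype.ext (symmDiff_symmDiff_cancel_right _ _)
  obtain ⟨s, hsS, hse⟩ : ∃ s ∈ X.1 ∆ Y.1, s ≠ e := by
    by_contra! h
    have hne : (X.1 ∆ Y.1).Nonempty := by
      rw [Finset.symmDiff_nonempty]
      exact fun h => hXY (Subtype.ext h)
    have hS : X.1 ∆ Y.1 = {e} := Finset.eq_singleton_iff_nonempty_unique_mem.2 ⟨hne, h⟩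
    have hmX : X.1 ∆ {e} ∈ L := hS ▸ hm X
    refine toggle_ne_self_iff.2 hmX (hout e X ?_)
    convert! hs X
    rw [toggle_val_of_mem hmX, hS]
  refine sign_eq_one_of_commute_of_exchange (σ := hinv.toPerm) ?_ (fun Z => s ∈ Z.1)
    (mem_toggle_iff_of_ne hse) ?_
  · intro Z
    apply Subtype.ext
    change (toggle L e Z).1 ∆ (X.1 ∆ Y.1) = (toggle L e ⟨_, hm Z⟩).1
    by_cases hf : toggle L e Z = Z
    · have hf' : toggle L e ⟨_, hm Z⟩ = ⟨_, hm Z⟩ := by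
        by_contra h
        exact (hout e).toggle_ne (hs Z).symm h hf
      rw [hf, hf']
    · rw [toggle_val_of_ne hf, toggle_val_of_ne ((hout e).toggle_ne (hs Z) hf),
        symmDiff_right_comm]
  · intro Z
    change s ∈ Z.1 ↔ s ∉ Z.1 ∆ (X.1 ∆ Y.1)
    rw [Finset.mem_symmDiff]
    tauto

theorem eq_top_of_forall_isInner {L : Finset (Finset E)} (htrans : IsTransitive L)
    (hin : ∀ e, IsInner L e) : toggleGroup L = ⊤ := by
  have hall : ∀ A Z, Swappable L A Z := fun A Z =>
    htrans.forall_of_toggle (P := Swappable L A) (fun e Z h => h.trans (hin e Z))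
      (Swappable.refl A) Z
  rw [eq_top_iff, ← Equiv.Perm.closure_isSwap, Subgroup.closure_le]
  rintro _ ⟨A, B, -, rfl⟩
  exact hall A B

/-- a transitive toggle group containing a transposition is the
full symmetric group on `L`. -/
theorem transitive_with_transposition_is_symmetric_group
    [Fintype E] (L : Finset (Finset E))
    (hnt : ∀ e : E, toggle L e ≠ 1)
    (htrans : IsTransitive L)
    (hswap : ∃ g ∈ toggleGroup L, ∃ A B : {A : Finset E // A ∈ L},
      A ≠ B ∧ g = Equiv.swap A B) :
    toggleGroup L = ⊤ := by
  obtain ⟨_, hg, X, Y, hXY, rfl⟩ := hswap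
  by_cases hout : ∀ e, IsOuter L e
  · have hle : toggleGroup L ≤ Equiv.Perm.sign.ker := by
      rw [toggleGroup, Subgroup.closure_le]
      rintro _ ⟨e, rfl⟩
      exact sign_toggle_eq_one_of_forall_isOuter htrans hout hXY hg e
    have h := MonoidHom.mem_ker.1 (hle hg)
    rw [Equiv.Perm.sign_swap hXY] at h
    exact absurd h (by decide)
  · obtain ⟨e, he⟩ := not_forall.1 hout
    exact eq_top_of_forall_isInner htrans (isInner_of_exists_not_isOuter htrans he)

end TogglePaper
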